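/- arXiv:1209.5618 — 2 statements merged into one kernel-verified Lean document; each statement's English description precedes it below -/
import Mathlib

section
/- Let R be a commutative ring, let d, g, k, ℓ ∈ R, and let n ≥ 3 be a natural number. Then (n+1)*d*\sum_{i=1}^{n-1} ℓ^{n-i-1} - ((n+1)*d - 2 + 2*g)*\sum_{i=0}^{n-1} C(n-1,i)*ℓ^{n-i-1} + (k-1)*d*\sum_{i=0}^{n-2} (n-i-1)*C(n-1,i)*ℓ^{n-i-2} + ((n+1)*d - 2 + 2*g)*\sum_{i=1}^{n-1} (C(n-2,i-1) - 1)*ℓ^{n-i-1} + (2 - 2*g)*\sum_{i=1}^{n-1} (C(n-1,i-1) - 1)*ℓ^{n-i-1} = (2 - 2*g)*\sum_{i=0}^{n-3} (ℓ+1)^i + (ℓ+1)^{n-2}*((2 - 2*g)*(ℓ+1) - (n+1)*d*ℓ + (k-1)*d*(n-1)). -/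
open Finset

theorem bb_pow {R : Type*} [CommRing R] (l : R) (m : ℕ) :
    ∑ j ∈ Finset.range (m + 1), (m.choose j : R) * l ^ (m - j) = (l + 1) ^ m := by
  rw [add_comm l 1, add_pow]
  refine Finset.sum_congr rfl fun j _ => ?_
  rw [one_pow]; ring

theorem bb_geom {R : Type*} [CommRing R] (l : R) (m : ℕ) :
    ∑ j ∈ Finset.range (m + 1), ((m + 1).choose j : R) * l ^ (m - j)
      = ∑ i ∈ Finset.range (m + 1), (l + 1) ^ i := by
  induction m with
  | zero => simp
  | succ m ih =>
    rw [Finset.sum_range_succ (fun i => (l + 1) ^ i) (m + 1), ← ih, ← bb_pow l (m + 1),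
      Finset.sum_range_succ' (fun j => ((m + 1 + 1).choose j : R) * l ^ (m + 1 - j)) (m + 1),
      Finset.sum_range_succ' (fun j => ((m + 1).choose j : R) * l ^ (m + 1 - j)) (m + 1),
      ← add_assoc, ← Finset.sum_add_distrib]
    congr 1
    · refine Finset.sum_congr rfl fun j _ => ?_
      rw [Nat.choose_succ_succ (m + 1) j, Nat.add_sub_add_right]
      push_cast; ring

theorem bb_der {R : Type*} [CommRing R] (l : R) (m : ℕ) :
    ∑ j ∈ Finset.range (m + 1), ((m + 1 - j : ℕ) : R) * ((m + 1).choose j : R) * l ^ (m - j)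
      = ((m : R) + 1) * (l + 1) ^ m := by
  rw [← bb_pow, Finset.mul_sum]
  refine Finset.sum_congr rfl fun j _ => ?_
  have h := congrArg (Nat.cast : ℕ → R) (Nat.choose_mul_succ_eq m j)
  push_cast at h
  linear_combination (-l ^ (m - j)) * h

theorem bb_Icc {R : Type*} [CommRing R] (f : ℕ → R) (m : ℕ) :
    ∑ i ∈ Finset.Icc 1 (m + 1), f i = ∑ j ∈ Finset.range (m + 1), f (j + 1) := by
  rw [Finset.range_eq_Ico, Finset.sum_Ico_add' f 0 (m + 1) 1]
  rfl

/-- The computational core of Theorem 3.1: the Baum–Bott integral over the exceptional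
divisor for a degree-`k` foliation on `ℙⁿ`, special along a smooth curve of degree `d`
and genus `g` with multiplicity `ℓ`, equals the closed-form count stated there. -/
theorem baum_bott_exceptional_divisor {R : Type*} [CommRing R] (d g k ℓ : R) (n : ℕ)
    (hn : 3 ≤ n) :
    ((n : R) + 1) * d * ∑ i ∈ Finset.Icc 1 (n - 1), ℓ ^ (n - i - 1)
      - (((n : R) + 1) * d - 2 + 2 * g) *
          ∑ i ∈ Finset.range n, ((n - 1).choose i : R) * ℓ ^ (n - i - 1)
      + (k - 1) * d *
          ∑ i ∈ Finset.range (n - 1), ((n - i - 1 : ℕ) : R) * ((n - 1).choose i : R) * ℓ ^ (n - i - 2)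
      + (((n : R) + 1) * d - 2 + 2 * g) *
          ∑ i ∈ Finset.Icc 1 (n - 1), (((n - 2).choose (i - 1) : R) - 1) * ℓ ^ (n - i - 1)
      + (2 - 2 * g) *
          ∑ i ∈ Finset.Icc 1 (n - 1), (((n - 1).choose (i - 1) : R) - 1) * ℓ ^ (n - i - 1) =
    (2 - 2 * g) * ∑ i ∈ Finset.range (n - 2), (ℓ + 1) ^ i
      + (ℓ + 1) ^ (n - 2) *
          ((2 - 2 * g) * (ℓ + 1) - ((n : R) + 1) * d * ℓ + (k - 1) * d * ((n : R) - 1)) := by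
  obtain ⟨m, rfl⟩ : ∃ m, n = m + 2 := ⟨n - 2, by omega⟩
  have e1 : m + 2 - 1 = m + 1 := rfl
  have e2 : m + 2 - 2 = m := rfl
  have e3 : ∀ j, m + 2 - (j + 1) - 1 = m - j := fun j => by omega
  have e4 : ∀ j, m + 2 - j - 1 = m + 1 - j := fun j => by omega
  have e5 : ∀ j, m + 2 - j - 2 = m - j := fun j => by omega
  simp only [e1, e2, bb_Icc, e3, Nat.add_sub_cancel, sub_mul, one_mul, Finset.sum_sub_distrib]
  simp only [e4, e5]
  rw [bb_pow, bb_geom, bb_der, bb_pow ℓ m, Finset.sum_range_succ (fun i => (ℓ + 1) ^ i) m]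
  push_cast
  ring
end

section
/- Let R be a commutative ring, let d, g, k, ℓ ∈ R, and let n ≥ 3 be a natural number. Then \sum_{i=0}^{n} C(n+1,i)*(k-1)^{n-i} - (n+1)*d*ℓ^{n-1} - ((n+1)*d - 2 + 2*g)*\sum_{i=0}^{n} (C(n-1,i-1) - C(n-1,i))*ℓ^{n-i} + (k-1)*d*\sum_{i=0}^{n-1} (n-i)*(C(n-1,i-1) - C(n-1,i))*ℓ^{n-i-1} + ((n+1)*d - 2 + 2*g)*\sum_{i=2}^{n} (C(n-2,i-2) - C(n-2,i-1))*ℓ^{n-i} + (2 - 2*g)*\sum_{i=2}^{n} (C(n-1,i-2) - C(n-1,i-1))*ℓ^{n-i} = \sum_{i=0}^{n} k^i + (2 - 2*g)*\sum_{i=0}^{n-3} (ℓ+1)^i + (ℓ+1)^{n-2}*((n+1)*d*(ℓ^2 - ℓ) - (2 - 2*g)*ℓ^2 - (k-1)*d*(n*ℓ - n + 2)). -/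
open Finset


theorem aux_G {R : Type*} [CommRing R] (x : R) (N : ℕ) :
    ∑ i ∈ Finset.range (N + 1), (N.choose i : R) * x ^ (N - i) = (x + 1) ^ N := by
  rw [add_comm x 1, add_pow]
  refine Finset.sum_congr rfl fun i _ => ?_
  rw [one_pow]; ring

/-- tail of the binomial sum -/
theorem aux_T {R : Type*} [CommRing R] (x : R) (N : ℕ) :
    ∑ i ∈ Finset.range (N + 1), (N.choose (i + 1) : R) * x ^ (N - i)
      = x * ((x + 1) ^ N - x ^ N) := by
  rw [← aux_G, Finset.sum_range_succ, Finset.sum_range_succ' _ N, Nat.choose_succ_self]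
  simp only [Nat.choose_zero_right, Nat.cast_one, Nat.sub_zero, one_mul, Nat.cast_zero, zero_mul,
    add_zero, add_sub_cancel_right, Finset.mul_sum]
  refine Finset.sum_congr rfl fun i hi => ?_
  have hi := Finset.mem_range.1 hi
  have h : N - i = (N - (i + 1)) + 1 := by omega
  rw [h, pow_succ]; ring

theorem aux_L {R : Type*} [CommRing R] (x : R) (N : ℕ) :
    ∑ i ∈ Finset.range (N + 1), ((N + 1).choose i : R) * x ^ (N - i)
      = ∑ i ∈ Finset.range (N + 1), (x + 1) ^ i := by
  induction N with
  | zero => simp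
  | succ N ih =>
    rw [Finset.sum_range_succ (fun i => (x + 1) ^ i) (N + 1), ← ih, ← aux_G x (N + 1), Finset.sum_range_succ' (fun i => ((N + 1 + 1).choose i : R) * x ^ (N + 1 - i)) (N + 1),
      Finset.sum_range_succ' (fun i => ((N + 1).choose i : R) * x ^ (N + 1 - i)) (N + 1), ← add_assoc, ← Finset.sum_add_distrib]
    congr 1
    · refine Finset.sum_congr rfl fun i _ => ?_
      rw [Nat.choose_succ_succ (N + 1) i, Nat.add_sub_add_right]
      push_cast; ring

theorem aux_S2 {R : Type*} [CommRing R] (x : R) (N : ℕ) :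
    ∑ i ∈ Finset.range (N + 1 + 1),
      ((if i = 0 then 0 else (N.choose (i - 1) : R)) - (N.choose i : R)) * x ^ (N + 1 - i)
      = (1 - x) * (x + 1) ^ N := by
  rw [Finset.sum_range_succ']
  simp only [Nat.succ_ne_zero, if_false, if_true, Nat.add_sub_cancel, Nat.add_sub_add_right,
    sub_mul, Finset.sum_sub_distrib, aux_G, aux_T, Nat.choose_zero_right, Nat.sub_zero]
  push_cast; ring

theorem aux_S3 {R : Type*} [CommRing R] (x : R) (N : ℕ) :
    ∑ i ∈ Finset.range (N + 2), ((N + 2 - i : ℕ) : R) *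
      ((if i = 0 then 0 else ((N + 1).choose (i - 1) : R)) - ((N + 1).choose i : R))
        * x ^ (N + 2 - i - 1)
      = (x + 1) ^ N * (N - (N + 2) * x) := by
  have h := congrArg (fun p => Polynomial.eval x (Polynomial.derivative p))
    (aux_S2 (Polynomial.X : Polynomial R) (N + 1))
  have e : ∀ i : ℕ, ((if i = 0 then 0 else ((N + 1).choose (i - 1) : Polynomial R))
      - ((N + 1).choose i : Polynomial R)) = Polynomial.C
      ((if i = 0 then 0 else ((N + 1).choose (i - 1) : R)) - ((N + 1).choose i : R)) := by
    intro i; split_ifs <;> simp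
  simp only [e, Polynomial.derivative_sum, Polynomial.eval_finsetSum,
    Polynomial.derivative_C_mul, Polynomial.derivative_X_pow] at h
  rw [Finset.sum_range_succ] at h
  simp [Polynomial.derivative_pow] at h
  refine Eq.trans (Finset.sum_congr rfl fun i _ => ?_) (h.trans ?_)
  · ring
  · ring

theorem aux_Icc {R : Type*} [CommRing R] (f : ℕ → R) (m : ℕ) :
    ∑ i ∈ Finset.Icc 2 (m + 2), f i = ∑ i ∈ Finset.range (m + 1), f (i + 2) := by
  rw [Finset.range_eq_Ico, Finset.sum_Ico_add' f 0 (m + 1) 2]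
  rfl

/-- The computational core of Theorem 3.3: the Baum–Bott integral over the blowup of `ℙⁿ`
along a smooth curve of degree `d` and genus `g`, for the strict transform of a degree-`k`
foliation special along the curve with multiplicity `ℓ`, equals the closed-form total
singularity count stated there. `C(n-1, -1) = 0` by convention. -/
theorem baum_bott_blowup {R : Type*} [CommRing R] (d g k ℓ : R) (n : ℕ) (hn : 3 ≤ n) :
    ∑ i ∈ Finset.range (n + 1), ((n + 1).choose i : R) * (k - 1) ^ (n - i)
      - ((n : R) + 1) * d * ℓ ^ (n - 1)
      - (((n : R) + 1) * d - 2 + 2 * g) *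
          ∑ i ∈ Finset.range (n + 1),
            ((if i = 0 then 0 else ((n - 1).choose (i - 1) : R)) - ((n - 1).choose i : R)) *
              ℓ ^ (n - i)
      + (k - 1) * d *
          ∑ i ∈ Finset.range n,
            ((n - i : ℕ) : R) *
              ((if i = 0 then 0 else ((n - 1).choose (i - 1) : R)) - ((n - 1).choose i : R)) *
                ℓ ^ (n - i - 1)
      + (((n : R) + 1) * d - 2 + 2 * g) *
          ∑ i ∈ Finset.Icc 2 n,
            (((n - 2).choose (i - 2) : R) - ((n - 2).choose (i - 1) : R)) * ℓ ^ (n - i)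
      + (2 - 2 * g) *
          ∑ i ∈ Finset.Icc 2 n,
            (((n - 1).choose (i - 2) : R) - ((n - 1).choose (i - 1) : R)) * ℓ ^ (n - i) =
    ∑ i ∈ Finset.range (n + 1), k ^ i
      + (2 - 2 * g) * ∑ i ∈ Finset.range (n - 2), (ℓ + 1) ^ i
      + (ℓ + 1) ^ (n - 2) *
          (((n : R) + 1) * d * (ℓ ^ 2 - ℓ) - (2 - 2 * g) * ℓ ^ 2
            - (k - 1) * d * ((n : R) * ℓ - (n : R) + 2)) := by
  obtain ⟨m, rfl⟩ : ∃ m, n = m + 2 := ⟨n - 2, by omega⟩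
  have e1 : m + 2 - 1 = m + 1 := rfl
  have e2 : m + 2 - 2 = m := rfl
  have e3 : ∀ i, i + 2 - 1 = i + 1 := fun _ => rfl
  have hL := aux_L (k - 1) (m + 2)
  have hS2 := aux_S2 ℓ (m + 1)
  have hS3 := aux_S3 ℓ m
  have hS5a := aux_L ℓ m
  have hS5b : ∑ i ∈ Finset.range (m + 1), ((m + 1).choose (i + 1) : R) * ℓ ^ (m - i)
      = (ℓ + 1) ^ (m + 1) - ℓ ^ (m + 1) := by
    rw [← aux_G, Finset.sum_range_succ' _ (m + 1)]
    simp
  rw [sub_add_cancel] at hL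
  rw [aux_Icc, aux_Icc]
  simp only [e1, e2, e3, Nat.add_sub_cancel, Nat.add_sub_add_right] at *
  rw [hL, hS2, hS3]
  simp only [sub_mul _ _ (ℓ ^ _), Finset.sum_sub_distrib, aux_G, aux_T, hS5a, hS5b]
  rw [Finset.sum_range_succ _ m]
  push_cast
  ring
end
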